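/- Let Γ_UCB be the single-index strategy. Then for every N ≥ 2, every θ ∈ [0,1]^N with maximal coordinate θ_{i*}, and every suboptimal channel i (i.e. θ_i < θ_{i*}), the expected number of slots in which Γ_UCB senses channel i during a block of length T > N satisfies E_θ[Y_i(T)] ≤ 8·ln T/(θ_{i*} − θ_i)² + 1 + π²/3, where Y_i(T) = #{ j ≤ T : S(j) = i }. -/

import Mathlib

open MeasureTheory ProbabilityTheory Filter
open scoped BigOperators ENNReal

/-- A deterministic medium-access strategy: it maps the history of
(sensed channel, observed outcome) pairs to the channel to be sensed in the next slot. -/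
def Strategy (N : ℕ) : Type := List (Fin N × Bool) → Fin N

/-- The history of (channel, outcome) pairs accumulated after `j` (0-indexed) slots, given
the full availability table `ω` (`ω j i = true` iff channel `i` is free in slot `j`). -/
def Strategy.hist {N : ℕ} (Γ : Strategy N) (ω : ℕ → Fin N → Bool) :
    ℕ → List (Fin N × Bool)
  | 0 => []
  | j + 1 =>
    Strategy.hist Γ ω j ++
      [(Γ (Strategy.hist Γ ω j), ω j (Γ (Strategy.hist Γ ω j)))]

/-- The channel selected by strategy `Γ` at (0-indexed) slot `j`. -/
def Strategy.sel {N : ℕ} (Γ : Strategy N) (ω : ℕ → Fin N → Bool) (j : ℕ) : Fin N :=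
  Γ (Γ.hist ω j)

/-- Extension of a finite availability table to all time slots. -/
def extendOut {N T : ℕ} (ω : Fin T → Fin N → Bool) : ℕ → Fin N → Bool :=
  fun j i => if h : j < T then ω ⟨j, h⟩ i else false

/-- The probability of observing the availability table `ω` when each channel `i` is free
in each slot independently with probability `θ i`. -/
def outWt {N T : ℕ} (θ : Fin N → ℝ) (ω : Fin T → Fin N → Bool) : ℝ :=
  ∏ j : Fin T, ∏ i : Fin N, (if ω j i then θ i else 1 - θ i)

/-- `W B θ T Γ`: the expected number of bits transmitted over a block of `T` slots by the
cognitive user employing strategy `Γ`, when `B` bits are sent each time the sensed channel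
is free, i.e. `E_θ[∑_{j=1}^T B · Z_{S(j)}(j)]`. -/
noncomputable def W {N : ℕ} (B : ℝ) (θ : Fin N → ℝ) (T : ℕ) (Γ : Strategy N) : ℝ :=
  ∑ ω : Fin T → Fin N → Bool, outWt θ ω *
    ∑ j ∈ Finset.range T, (if extendOut ω j (Γ.sel (extendOut ω) j) then B else 0)

/-- `probSel θ T Γ j i`: the probability that strategy `Γ` selects channel `i` at
(0-indexed) slot `j`, under parameter `θ`. -/
noncomputable def probSel {N : ℕ} (θ : Fin N → ℝ) (T : ℕ) (Γ : Strategy N)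
    (j : ℕ) (i : Fin N) : ℝ :=
  ∑ ω : Fin T → Fin N → Bool, (if Γ.sel (extendOut ω) j = i then outWt θ ω else 0)

/-- `expY θ T Γ i`: the expected number of slots among the first `T` in which strategy `Γ`
senses channel `i`, i.e. `E_θ[Y_i(T)]`. -/
noncomputable def expY {N : ℕ} (θ : Fin N → ℝ) (T : ℕ) (Γ : Strategy N) (i : Fin N) : ℝ :=
  ∑ ω : Fin T → Fin N → Bool, outWt θ ω *
    (((Finset.range T).filter fun j => Γ.sel (extendOut ω) j = i).card : ℝ)

/-- The throughput loss of strategy `Γ` over a block of `T` slots, relative to always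
sensing a best channel `istar`: `L(θ;Γ,T) = T·B·θ_{i*} − W_Γ(θ,T)`. -/
noncomputable def Loss {N : ℕ} (B : ℝ) (θ : Fin N → ℝ) (istar : Fin N) (T : ℕ)
    (Γ : Strategy N) : ℝ :=
  T * B * θ istar - W B θ T Γ

/-- A family of strategies (one for each horizon `T`) is consistent if for every
`θ ∈ [0,1]^N` there are `β < 1` and `C > 0` with `L(θ;Γ_T,T) ≤ C·T^β` for all `T ≥ 1`. -/
def Consistent {N : ℕ} (B : ℝ) (Γ : ℕ → Strategy N) : Prop :=
  ∀ θ : Fin N → ℝ, (∀ i, θ i ∈ Set.Icc (0:ℝ) 1) →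
    ∀ istar : Fin N, (∀ k, θ k ≤ θ istar) →
      ∃ β C : ℝ, β < 1 ∧ 0 < C ∧
        ∀ T : ℕ, 1 ≤ T → Loss B θ istar T (Γ T) ≤ C * (T : ℝ) ^ β

/-- The Bayesian expected throughput of strategy `Γ` under prior `f`. -/
noncomputable def WBayes {N : ℕ} (B : ℝ) (T : ℕ) (Γ : Strategy N)
    (f : Measure (Fin N → ℝ)) : ℝ :=
  ∫ θ, W B θ T Γ ∂f

/-- The optimal Bayesian value `V*(f,T) = sup_Γ W_Γ(f,T)`. -/
noncomputable def Vstar {N : ℕ} (B : ℝ) (T : ℕ) (f : Measure (Fin N → ℝ)) : ℝ :=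
  ⨆ Γ : Strategy N, WBayes B T Γ f

/-- The Bayesian posterior after sensing channel `i` and observing outcome `z`:
`f_{z_i=1}` has density `θ_i / ∫θ_i f(dθ)` w.r.t. `f`, and `f_{z_i=0}` has density
`(1−θ_i) / ∫(1−θ_i) f(dθ)` w.r.t. `f`. -/
noncomputable def posterior {N : ℕ} (f : Measure (Fin N → ℝ)) (i : Fin N) (z : Bool) :
    Measure (Fin N → ℝ) :=
  if z then f.withDensity fun θ => ENNReal.ofReal (θ i / ∫ θ', θ' i ∂f)
  else f.withDensity fun θ => ENNReal.ofReal ((1 - θ i) / ∫ θ', (1 - θ' i) ∂f)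

/-- Kullback–Leibler divergence between Bernoulli(a) and Bernoulli(b). -/
noncomputable def klBernoulli (a b : ℝ) : ℝ :=
  a * Real.log (a / b) + (1 - a) * Real.log ((1 - a) / (1 - b))

/-- The UCB single index of channel `i` given history `h` (the history has length `j − 1`
when the current slot is `j`, 1-indexed): `Λ_i(j) = X_i(j)/Y_i(j) + sqrt(2·ln j/Y_i(j))`,
where `Y_i(j)` is the number of past slots in which channel `i` was sensed and `X_i(j)`
the number of past slots in which it was sensed and found free. -/
noncomputable def ucbIndex {N : ℕ} (h : List (Fin N × Bool)) (i : Fin N) : ℝ :=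
  ((h.filter fun p => p.1 == i && p.2).length : ℝ)
      / ((h.filter fun p => p.1 == i).length : ℝ)
    + Real.sqrt (2 * Real.log (h.length + 1)
      / ((h.filter fun p => p.1 == i).length : ℝ))

/-- The order-optimal single index (UCB) strategy: in the first `N` slots each channel is
sensed once (channel `j` at slot `j`); thereafter the strategy senses a channel maximizing
the index `Λ_i(j)`, ties broken in favor of the lowest channel index. -/
noncomputable def ucbStrategy (N : ℕ) (hN : 0 < N) : Strategy N := fun h => by
  classical
  exact
    if hlt : h.length < N then ⟨h.length, hlt⟩
    else
      (Finset.univ.filter fun i : Fin N => ∀ k, ucbIndex h k ≤ ucbIndex h i).min'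
        (by
          haveI : Nonempty (Fin N) := ⟨⟨0, hN⟩⟩
          obtain ⟨i, -, hi⟩ := Finset.exists_max_image (Finset.univ : Finset (Fin N))
            (ucbIndex h) Finset.univ_nonempty
          exact ⟨i, Finset.mem_filter.mpr
            ⟨Finset.mem_univ _, fun k => hi k (Finset.mem_univ k)⟩⟩)

/-- The number of times channel `i` has been sensed in the history `h`. -/
def sensedCount {N : ℕ} (h : List (Fin N × Bool)) (i : Fin N) : ℕ :=
  (h.filter fun p => p.1 == i).length

/-- The number of times channel `i` has been sensed and found free in the history `h`. -/
def freeCount {N : ℕ} (h : List (Fin N × Bool)) (i : Fin N) : ℕ :=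
  (h.filter fun p => p.1 == i && p.2).length

/-- The exponential supermartingale behind Hoeffding's inequality for the observations of
channel `i` recorded in `h`, when the channel is free with probability `a`. -/
noncomputable def hoeffdingWeight {N : ℕ} (a l : ℝ) (h : List (Fin N × Bool)) (i : Fin N) : ℝ :=
  Real.exp (l * (freeCount h i - a * sensedCount h i) - l ^ 2 / 8 * sensedCount h i)

/-- The expectation of a function of the availability table of the first `T` slots. -/
noncomputable def outExp {N : ℕ} (θ : Fin N → ℝ) (T : ℕ) (f : (ℕ → Fin N → Bool) → ℝ) : ℝ :=
  ∑ ω : Fin T → Fin N → Bool, outWt θ ω * f (extendOut ω)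

/-- Hoeffding's lemma for a Bernoulli variable. -/
lemma bernoulli_exp_le {a : ℝ} (ha : a ∈ Set.Icc (0 : ℝ) 1) (l : ℝ) :
    a * Real.exp (l * (1 - a)) + (1 - a) * Real.exp (l * (0 - a)) ≤ Real.exp (l ^ 2 / 8) := by
  let μ : Measure ℝ := bernoulliMeasure 1 0 ⟨a, ha⟩
  have hsub := hasSubgaussianMGF_of_mem_Icc (μ := μ) (X := id) (a := 0) (b := 1)
    aemeasurable_id (ae_add_measure_iff.mpr
      ⟨Measure.ae_smul_measure (by simp) _,
        Measure.ae_smul_measure (by simp) _⟩)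
  have hmean : μ[id] = a := by
    simp [μ, integral_bernoulliMeasure]
  have hmgf := hsub.mgf_le l
  rw [hmean] at hmgf
  convert! hmgf using 1
  · simp [mgf, μ, integral_bernoulliMeasure]
  · congr 1
    simp
    ring

section Counts

variable {N : ℕ} (h : List (Fin N × Bool)) (p : Fin N × Bool) (i : Fin N)

lemma sensedCount_append :
    sensedCount (h ++ [p]) i = sensedCount h i + if p.1 = i then 1 else 0 := by
  simp only [sensedCount, List.filter_append, List.length_append]
  split_ifs with hp <;> simp [hp]

lemma freeCount_append :
    freeCount (h ++ [p]) i = freeCount h i + if p.1 = i ∧ p.2 = true then 1 else 0 := by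
  simp only [freeCount, List.filter_append, List.length_append]
  split_ifs with hp
  · simp [hp]
  · have : (p.1 == i && p.2) = false := by simpa using hp
    simp [this]

lemma sensedCount_le_length : sensedCount h i ≤ h.length :=
  List.length_filter_le _ _

lemma ucbIndex_eq :
    ucbIndex h i = freeCount h i / sensedCount h i
      + Real.sqrt (2 * Real.log (h.length + 1) / sensedCount h i) := rfl

lemma hoeffdingWeight_append (a l : ℝ) :
    hoeffdingWeight a l (h ++ [p]) i = hoeffdingWeight a l h i *
      if p.1 = i then Real.exp (l * ((if p.2 then 1 else 0) - a)) * Real.exp (-(l ^ 2 / 8))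
      else 1 := by
  simp only [hoeffdingWeight, sensedCount_append, freeCount_append]
  by_cases hi : p.1 = i
  · simp only [hi, true_and, if_true, ← Real.exp_add]
    congr 1
    cases p.2 <;> simp <;> ring
  · simp [hi]

end Counts

section History

variable {N : ℕ} (Γ : Strategy N)

lemma hist_succ (ω : ℕ → Fin N → Bool) (j : ℕ) :
    Γ.hist ω (j + 1) = Γ.hist ω j ++ [(Γ.sel ω j, ω j (Γ.sel ω j))] := rfl

lemma length_hist (ω : ℕ → Fin N → Bool) (j : ℕ) : (Γ.hist ω j).length = j := by
  induction j with
  | zero => rfl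
  | succ j ih => simp [hist_succ, ih]

lemma hist_congr {ω ω' : ℕ → Fin N → Bool} {j : ℕ} (hω : ∀ k < j, ω k = ω' k) :
    Γ.hist ω j = Γ.hist ω' j := by
  induction j with
  | zero => rfl
  | succ j ih =>
    have hj := ih fun k hk => hω k (hk.trans j.lt_succ_self)
    simp only [hist_succ, Strategy.sel, hj, hω j j.lt_succ_self]

lemma sensedCount_hist (ω : ℕ → Fin N → Bool) (j : ℕ) (i : Fin N) :
    sensedCount (Γ.hist ω j) i = ((Finset.range j).filter fun k => Γ.sel ω k = i).card := by
  induction j with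
  | zero => simp [Strategy.hist, sensedCount]
  | succ j ih =>
    rw [hist_succ, sensedCount_append, ih, Finset.range_add_one, Finset.filter_insert]
    split_ifs <;> simp_all

end History

section Expectation

variable {N : ℕ} {θ : Fin N → ℝ}

lemma outWt_nonneg (hθ : ∀ i, θ i ∈ Set.Icc (0 : ℝ) 1) {T : ℕ} (ω : Fin T → Fin N → Bool) :
    0 ≤ outWt θ ω := by
  refine Finset.prod_nonneg fun j _ => Finset.prod_nonneg fun i _ => ?_
  have := hθ i
  split_ifs <;> linarith [this.1, this.2]

lemma outWt_snoc {T : ℕ} (ω : Fin T → Fin N → Bool) (r : Fin N → Bool) :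
    outWt θ (Fin.snoc ω r : Fin (T + 1) → Fin N → Bool)
      = outWt θ ω * ∏ i, (if r i then θ i else 1 - θ i) := by
  simp [outWt, Fin.prod_univ_castSucc]

lemma extendOut_snoc_of_lt {T : ℕ} (ω : Fin T → Fin N → Bool) (r : Fin N → Bool) {k : ℕ}
    (hk : k < T) :
    extendOut (Fin.snoc ω r : Fin (T + 1) → Fin N → Bool) k = extendOut ω k := by
  funext i
  simp [extendOut, hk, hk.trans T.lt_succ_self, Fin.snoc]

lemma extendOut_snoc_last {T : ℕ} (ω : Fin T → Fin N → Bool) (r : Fin N → Bool) :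
    extendOut (Fin.snoc ω r : Fin (T + 1) → Fin N → Bool) T = r := by
  funext i
  simp [extendOut, Fin.snoc]

lemma outExp_succ (T : ℕ) (f : (ℕ → Fin N → Bool) → ℝ) :
    outExp θ (T + 1) f = ∑ ω : Fin T → Fin N → Bool, outWt θ ω *
      ∑ r : Fin N → Bool, (∏ i, (if r i then θ i else 1 - θ i)) *
        f (extendOut (Fin.snoc ω r : Fin (T + 1) → Fin N → Bool)) := by
  rw [outExp, ← (Fin.snocEquiv fun _ => Fin N → Bool).sum_comp, Fintype.sum_prod_type_right]
  refine Finset.sum_congr rfl fun ω _ => ?_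
  rw [Finset.mul_sum]
  refine Finset.sum_congr rfl fun r _ => ?_
  rw [← mul_assoc, ← outWt_snoc]
  rfl

lemma sum_row_eq (c : Fin N) (φ : Bool → ℝ) :
    ∑ r : Fin N → Bool, (∏ i, (if r i then θ i else 1 - θ i)) * φ (r c)
      = θ c * φ true + (1 - θ c) * φ false := by
  have key := Finset.prod_univ_sum (fun _ : Fin N => (Finset.univ : Finset Bool))
    (fun i b => (if b then θ i else 1 - θ i) * if i = c then φ b else 1)
  rw [Fintype.piFinset_univ] at key
  calc
    _ = ∑ r : Fin N → Bool,
        ∏ i, ((if r i then θ i else 1 - θ i) * if i = c then φ (r i) else 1) := by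
      refine Finset.sum_congr rfl fun r _ => ?_
      rw [Finset.prod_mul_distrib, Finset.prod_ite_eq' Finset.univ c]
      simp
    _ = _ := by
      rw [← key, Finset.prod_eq_single c]
      · simp
      · intro i _ hi
        simp [hi]
      · simp

lemma sum_row_one : ∑ r : Fin N → Bool, ∏ i, (if r i then θ i else 1 - θ i) = 1 := by
  have key := Finset.prod_univ_sum (fun _ : Fin N => (Finset.univ : Finset Bool))
    (fun i b => if b then θ i else 1 - θ i)
  rw [Fintype.piFinset_univ] at key
  rw [← key]
  simp

lemma outExp_const (T : ℕ) (c : ℝ) : outExp θ T (fun _ => c) = c := by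
  induction T with
  | zero => simp [outExp, outWt]
  | succ T ih =>
    rw [outExp_succ]
    simp only [← Finset.sum_mul, sum_row_one, one_mul]
    rwa [outExp, ← Finset.sum_mul] at ih

lemma outExp_add (T : ℕ) (f g : (ℕ → Fin N → Bool) → ℝ) :
    outExp θ T (fun ω => f ω + g ω) = outExp θ T f + outExp θ T g := by
  simp [outExp, mul_add, Finset.sum_add_distrib]

lemma outExp_const_mul (T : ℕ) (c : ℝ) (f : (ℕ → Fin N → Bool) → ℝ) :
    outExp θ T (fun ω => c * f ω) = c * outExp θ T f := by
  simp only [outExp, Finset.mul_sum, mul_left_comm]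

lemma outExp_sum {ι : Type*} (T : ℕ) (s : Finset ι) (f : ι → (ℕ → Fin N → Bool) → ℝ) :
    outExp θ T (fun ω => ∑ x ∈ s, f x ω) = ∑ x ∈ s, outExp θ T (f x) := by
  simp only [outExp, Finset.mul_sum]
  exact Finset.sum_comm

lemma outExp_mono (hθ : ∀ i, θ i ∈ Set.Icc (0 : ℝ) 1) (T : ℕ) {f g : (ℕ → Fin N → Bool) → ℝ}
    (hfg : ∀ ω, f ω ≤ g ω) : outExp θ T f ≤ outExp θ T g :=
  Finset.sum_le_sum fun ω _ => mul_le_mul_of_nonneg_left (hfg _) (outWt_nonneg hθ ω)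

/-- The exponential process of a channel has expectation at most one, whatever the strategy. -/
lemma outExp_hoeffdingWeight_le (hθ : ∀ i, θ i ∈ Set.Icc (0 : ℝ) 1) (Γ : Strategy N) (i : Fin N)
    (l : ℝ) (T j : ℕ) (hj : j ≤ T) :
    outExp θ T (fun ω => hoeffdingWeight (θ i) l (Γ.hist ω j) i) ≤ 1 := by
  induction T generalizing j with
  | zero =>
    obtain rfl : j = 0 := by omega
    simp [outExp, outWt, Strategy.hist, hoeffdingWeight, freeCount, sensedCount]
  | succ T ih =>
    have hfirst (k : ℕ) (hk : k ≤ T) (ω : Fin T → Fin N → Bool) (r : Fin N → Bool) :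
        Γ.hist (extendOut (Fin.snoc ω r : Fin (T + 1) → Fin N → Bool)) k
          = Γ.hist (extendOut ω) k :=
      hist_congr Γ fun m hm => extendOut_snoc_of_lt ω r (hm.trans_le hk)
    rw [outExp_succ]
    rcases Nat.lt_or_eq_of_le hj with hlt | rfl
    · have hjT : j ≤ T := by omega
      simp only [hfirst j hjT, ← Finset.sum_mul, sum_row_one, one_mul]
      exact ih j hjT
    · refine le_trans (Finset.sum_le_sum fun ω _ =>
        mul_le_mul_of_nonneg_left ?_ (outWt_nonneg hθ ω)) (ih T le_rfl)
      simp only [hist_succ, Strategy.sel, hfirst T le_rfl, extendOut_snoc_last,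
        hoeffdingWeight_append]
      set c := Γ (Γ.hist (extendOut ω) T)
      set w := hoeffdingWeight (θ i) l (Γ.hist (extendOut ω) T) i
      rw [sum_row_eq c fun b => w * if c = i then
        Real.exp (l * ((if b then 1 else 0) - θ i)) * Real.exp (-(l ^ 2 / 8)) else 1]
      have hw : 0 ≤ w := (Real.exp_pos _).le
      by_cases hc : c = i
      · have hb := mul_le_mul_of_nonneg_right (bernoulli_exp_le (hθ i) l)
          (Real.exp_pos (-(l ^ 2 / 8))).le
        rw [← Real.exp_add, add_neg_cancel, Real.exp_zero] at hb
        have := mul_le_mul_of_nonneg_left hb hw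
        simp only [hc, if_true, Bool.false_eq_true, if_false]
        linarith
      · simp only [hc, if_false]
        linarith

end Expectation

/-- A deviation by the confidence radius, in the direction `e = ±1`, makes the exponential
weight large. -/
lemma one_le_exp_mul_hoeffdingWeight {N : ℕ} {h : List (Fin N × Bool)} {i : Fin N} {a e L : ℝ}
    (he : e ^ 2 = 1) (hL : 0 ≤ L) (hs : 0 < sensedCount h i)
    (hdev : sensedCount h i * Real.sqrt (2 * L / sensedCount h i)
      ≤ e * (freeCount h i - a * sensedCount h i)) :
    1 ≤ Real.exp (-(4 * L)) *
      hoeffdingWeight a (e * (4 * Real.sqrt (2 * L / sensedCount h i))) h i := by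
  have hs' : (0 : ℝ) < sensedCount h i := by exact_mod_cast hs
  set s : ℝ := (sensedCount h i : ℝ)
  set c := Real.sqrt (2 * L / s)
  have hc : c ^ 2 * s = 2 * L := by
    rw [Real.sq_sqrt (by positivity)]
    field_simp
  rw [hoeffdingWeight, ← Real.exp_add, Real.one_le_exp_iff]
  have := mul_le_mul_of_nonneg_left hdev (show 0 ≤ 4 * c by positivity)
  have hsq : (e * (4 * c)) ^ 2 / 8 * s = 2 * (c ^ 2 * s) := by
    rw [mul_pow, he]
    ring
  rw [hsq]
  linarith

section UCB

variable {N : ℕ}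

lemma ucbStrategy_of_lt (hN : 0 < N) {h : List (Fin N × Bool)} (hlt : h.length < N) :
    ucbStrategy N hN h = ⟨h.length, hlt⟩ := by
  simp [ucbStrategy, hlt]

lemma ucbIndex_le_ucbStrategy (hN : 0 < N) {h : List (Fin N × Bool)} (hle : N ≤ h.length)
    (k : Fin N) : ucbIndex h k ≤ ucbIndex h (ucbStrategy N hN h) := by
  classical
  simp only [ucbStrategy, not_lt.mpr hle, dif_neg, not_false_eq_true]
  exact (Finset.mem_filter.mp (Finset.min'_mem (Finset.univ.filter fun i : Fin N =>
    ∀ k, ucbIndex h k ≤ ucbIndex h i) _)).2 k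

lemma ucb_sel_of_lt (hN : 0 < N) (ω : ℕ → Fin N → Bool) {j : ℕ} (hj : j < N) :
    (ucbStrategy N hN).sel ω j = ⟨j, hj⟩ := by
  have hlen := length_hist (ucbStrategy N hN) ω j
  rw [Strategy.sel, ucbStrategy_of_lt hN (by rwa [hlen])]
  simp [hlen]

lemma ucb_sensedCount_pos (hN : 0 < N) (ω : ℕ → Fin N → Bool) {j : ℕ} (hj : N ≤ j) (i : Fin N) :
    0 < sensedCount ((ucbStrategy N hN).hist ω j) i := by
  rw [sensedCount_hist, Finset.card_pos]
  exact ⟨i, by simp [ucb_sel_of_lt hN ω i.2, i.2.trans_le hj]⟩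

lemma le_of_ucb_sel_of_sensedCount_pos (hN : 0 < N) (ω : ℕ → Fin N → Bool) {j : ℕ} {i : Fin N}
    (hsel : (ucbStrategy N hN).sel ω j = i)
    (hpos : 0 < sensedCount ((ucbStrategy N hN).hist ω j) i) : N ≤ j := by
  by_contra! hj
  rw [sensedCount_hist, Finset.card_pos] at hpos
  obtain ⟨k, hk⟩ := hpos
  simp only [Finset.mem_filter, Finset.mem_range] at hk
  have hki := hk.2
  rw [← hsel, ucb_sel_of_lt hN ω hj, ucb_sel_of_lt hN ω (hk.1.trans hj), Fin.mk.injEq] at hki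
  omega

/-- When a sufficiently sampled suboptimal channel has the larger index, one of the two
empirical means is off by at least its confidence radius. -/
lemma deviation_of_ucbIndex_le {h : List (Fin N × Bool)} {i k : Fin N} {a b L : ℝ}
    (hab : a < b) (hlog : Real.log (h.length + 1) ≤ L)
    (hi : 0 < sensedCount h i) (hk : 0 < sensedCount h k)
    (hle : ucbIndex h k ≤ ucbIndex h i) (hs : 8 * L / (b - a) ^ 2 ≤ sensedCount h i) :
    sensedCount h k * Real.sqrt (2 * Real.log (h.length + 1) / sensedCount h k)
        ≤ -1 * (freeCount h k - b * sensedCount h k) ∨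
      sensedCount h i * Real.sqrt (2 * Real.log (h.length + 1) / sensedCount h i)
        ≤ 1 * (freeCount h i - a * sensedCount h i) := by
  have hi' : (0 : ℝ) < sensedCount h i := by exact_mod_cast hi
  have hk' : (0 : ℝ) < sensedCount h k := by exact_mod_cast hk
  rw [ucbIndex_eq, ucbIndex_eq] at hle
  by_contra! hcon
  obtain ⟨h1, h2⟩ := hcon
  set ck := Real.sqrt (2 * Real.log (h.length + 1) / sensedCount h k)
  set ci := Real.sqrt (2 * Real.log (h.length + 1) / sensedCount h i) with hci
  have h1' : b - ck < freeCount h k / sensedCount h k := by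
    rw [lt_div_iff₀ hk']
    linarith
  have h2' : (freeCount h i : ℝ) / sensedCount h i < a + ci := by
    rw [div_lt_iff₀ hi']
    linarith
  have hgap : b - a < 2 * ci := by linarith
  have hrad : ci ≤ (b - a) / 2 := by
    rw [hci, Real.sqrt_le_left (by linarith), div_le_iff₀ hi']
    rw [div_le_iff₀ (pow_pos (sub_pos.mpr hab) 2)] at hs
    linarith
  linarith

/-- The occurrences of an event among the first `T` times, up to its first `l` occurrences. -/
lemma card_filter_range_le_add (p : ℕ → Prop) [DecidablePred p] (l T : ℕ) :
    ((Finset.range T).filter p).card ≤ l + ((Finset.range T).filter fun j =>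
      p j ∧ l ≤ ((Finset.range j).filter p).card).card := by
  induction T with
  | zero => simp
  | succ T ih =>
    simp only [Finset.range_add_one, Finset.filter_insert]
    by_cases hp : p T
    · by_cases hl : l ≤ ((Finset.range T).filter p).card
      · simp only [hp, hl, and_self, if_true]
        rw [Finset.card_insert_of_notMem (by simp), Finset.card_insert_of_notMem (by simp)]
        omega
      · simp only [hp, hl, and_false, if_true, if_false]
        rw [Finset.card_insert_of_notMem (by simp)]
        omega
    · simpa [hp] using ih

/-- Pathwise bound on the number of plays of a suboptimal channel. -/
lemma ucb_card_sel_le (hN : 0 < N) {θ : Fin N → ℝ} {i k : Fin N} (hik : θ i < θ k) {T l : ℕ}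
    (hl : 0 < l) (hlT : 8 * Real.log T / (θ k - θ i) ^ 2 ≤ l) (ω : ℕ → Fin N → Bool) :
    (((Finset.range T).filter fun j => (ucbStrategy N hN).sel ω j = i).card : ℝ) ≤
      l + ∑ j ∈ Finset.range T, ∑ s ∈ Finset.Icc 1 j, Real.exp (-(4 * Real.log (j + 1))) *
        (hoeffdingWeight (θ k) (-1 * (4 * Real.sqrt (2 * Real.log (j + 1) / s)))
            ((ucbStrategy N hN).hist ω j) k +
          hoeffdingWeight (θ i) (1 * (4 * Real.sqrt (2 * Real.log (j + 1) / s)))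
            ((ucbStrategy N hN).hist ω j) i) := by
  have hcard := card_filter_range_le_add (fun j => (ucbStrategy N hN).sel ω j = i) l T
  refine (Nat.cast_le (α := ℝ).mpr hcard).trans ?_
  rw [Nat.cast_add, Finset.card_filter, Nat.cast_sum]
  gcongr with j hj
  have hterm (s : ℕ) : 0 ≤ Real.exp (-(4 * Real.log (j + 1))) *
        (hoeffdingWeight (θ k) (-1 * (4 * Real.sqrt (2 * Real.log (j + 1) / s)))
            ((ucbStrategy N hN).hist ω j) k +
          hoeffdingWeight (θ i) (1 * (4 * Real.sqrt (2 * Real.log (j + 1) / s)))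
            ((ucbStrategy N hN).hist ω j) i) := by
    unfold hoeffdingWeight
    positivity
  split_ifs with hsel
  swap
  · simpa using Finset.sum_nonneg fun s _ => hterm s
  obtain ⟨hsel, hcount⟩ := hsel
  rw [← sensedCount_hist] at hcount
  have hposi := hl.trans_le hcount
  have hNj := le_of_ucb_sel_of_sensedCount_pos hN ω hsel hposi
  have hposk := ucb_sensedCount_pos hN ω hNj k
  have hlen := length_hist (ucbStrategy N hN) ω j
  have hindex := ucbIndex_le_ucbStrategy hN (hNj.trans_eq hlen.symm) k
  rw [show ucbStrategy N hN ((ucbStrategy N hN).hist ω j) = i from hsel] at hindex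
  have hjT : (j : ℝ) + 1 ≤ T := by exact_mod_cast Finset.mem_range.mp hj
  have hlog : Real.log (j + 1) ≤ Real.log T := Real.log_le_log (by positivity) hjT
  have hlog0 : 0 ≤ Real.log ((j : ℝ) + 1) := Real.log_nonneg (by simp)
  have hdev := deviation_of_ucbIndex_le hik (by rwa [hlen]) hposi hposk hindex
    (hlT.trans (Nat.cast_le.mpr hcount))
  have hmem (m : Fin N) (hm : 0 < sensedCount ((ucbStrategy N hN).hist ω j) m) :
      sensedCount ((ucbStrategy N hN).hist ω j) m ∈ Finset.Icc 1 j :=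
    Finset.mem_Icc.mpr ⟨hm, (sensedCount_le_length _ _).trans_eq hlen⟩
  rw [hlen] at hdev
  rw [Nat.cast_one]
  rcases hdev with hdev | hdev
  · refine le_trans ?_ (Finset.single_le_sum (fun s _ => hterm s) (hmem k hposk))
    refine (one_le_exp_mul_hoeffdingWeight (by norm_num) hlog0 hposk hdev).trans ?_
    gcongr
    exact le_add_of_nonneg_right (Real.exp_pos _).le
  · refine le_trans ?_ (Finset.single_le_sum (fun s _ => hterm s) (hmem i hposi))
    refine (one_le_exp_mul_hoeffdingWeight (by norm_num) hlog0 hposi hdev).trans ?_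
    gcongr
    exact le_add_of_nonneg_left (Real.exp_pos _).le

end UCB

lemma sum_exp_neg_log_le (T : ℕ) :
    ∑ j ∈ Finset.range T, ∑ _s ∈ Finset.Icc 1 j, Real.exp (-(4 * Real.log (j + 1))) * 2
      ≤ Real.pi ^ 2 / 3 := by
  have hzeta := (hasSum_nat_add_iff' 1).mpr hasSum_zeta_two
  have hle := sum_le_hasSum (Finset.range T) (fun j _ => by positivity) hzeta
  have hterm (j : ℕ) : ∑ _s ∈ Finset.Icc 1 j, Real.exp (-(4 * Real.log (j + 1))) * 2
      ≤ 2 * (1 / ((j + 1 : ℕ) : ℝ) ^ 2) := by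
    have hpos : (0 : ℝ) < j + 1 := by positivity
    have hexp : Real.exp (-(4 * Real.log (j + 1))) = 1 / ((j : ℝ) + 1) ^ 4 := by
      rw [Real.exp_neg, mul_comm, Real.exp_mul, Real.exp_log hpos, one_div]
      norm_cast
    rw [Finset.sum_const, Nat.card_Icc, hexp, nsmul_eq_mul]
    push_cast [Nat.add_sub_cancel]
    rw [show (j : ℝ) * (1 / (j + 1) ^ 4 * 2) = 2 * (j / (j + 1) ^ 4) by ring]
    gcongr 2 * ?_
    rw [div_le_div_iff₀ (by positivity) (by positivity)]
    have hj : (j : ℝ) ≤ (j + 1) ^ 2 := by nlinarith [(Nat.cast_nonneg j : (0 : ℝ) ≤ j)]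
    nlinarith [mul_le_mul_of_nonneg_right hj (sq_nonneg ((j : ℝ) + 1))]
  refine (Finset.sum_le_sum fun j _ => hterm j).trans ?_
  rw [← Finset.mul_sum]
  simp only [Finset.range_one, Finset.sum_singleton, Nat.cast_zero] at hle
  norm_num at hle ⊢
  linarith

/-- **UCB sampling bound.** For `N ≥ 2`, any `θ ∈ [0,1]^N` with maximal
coordinate `θ_{i*}`, any suboptimal channel `i` (`θ_i < θ_{i*}`) and any block length
`T > N`, the expected number of slots in which the single-index strategy senses channel
`i` satisfies `E_θ[Y_i(T)] ≤ 8·ln T/(θ_{i*} − θ_i)² + 1 + π²/3`. -/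
theorem ucb_expected_suboptimal_plays {N : ℕ} (hN : 2 ≤ N)
    (θ : Fin N → ℝ) (hθ : ∀ i, θ i ∈ Set.Icc (0:ℝ) 1)
    (istar : Fin N) (hmax : ∀ k, θ k ≤ θ istar)
    (i : Fin N) (hi : θ i < θ istar) (T : ℕ) (hT : N < T) :
    expY θ T (ucbStrategy N (by omega)) i
      ≤ 8 * Real.log T / (θ istar - θ i) ^ 2 + 1 + Real.pi ^ 2 / 3 := by
  have hN0 : 0 < N := by omega
  have hT1 : (1 : ℝ) < T := by exact_mod_cast (by omega : 1 < T)
  have hgap : 0 < θ istar - θ i := sub_pos.mpr hi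
  have hbudget : 0 < 8 * Real.log T / (θ istar - θ i) ^ 2 := by
    have := Real.log_pos hT1
    positivity
  set l := ⌈8 * Real.log T / (θ istar - θ i) ^ 2⌉₊
  have hl : 0 < l := Nat.ceil_pos.mpr hbudget
  have hl_lt : (l : ℝ) < 8 * Real.log T / (θ istar - θ i) ^ 2 + 1 :=
    Nat.ceil_lt_add_one hbudget.le
  have hmono := outExp_mono hθ T fun ω => ucb_card_sel_le hN0 hi hl (Nat.le_ceil _) ω
  have htail : ∀ j ∈ Finset.range T, ∀ s ∈ Finset.Icc 1 j,
      outExp θ T (fun ω => Real.exp (-(4 * Real.log (j + 1))) *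
        (hoeffdingWeight (θ istar) (-1 * (4 * Real.sqrt (2 * Real.log (j + 1) / s)))
            ((ucbStrategy N hN0).hist ω j) istar +
          hoeffdingWeight (θ i) (1 * (4 * Real.sqrt (2 * Real.log (j + 1) / s)))
            ((ucbStrategy N hN0).hist ω j) i))
        ≤ Real.exp (-(4 * Real.log (j + 1))) * 2 := by
    intro j hj s _
    have hjT := (Finset.mem_range.mp hj).le
    rw [outExp_const_mul, outExp_add]
    gcongr
    linarith [outExp_hoeffdingWeight_le hθ (ucbStrategy N hN0) istar
        (-1 * (4 * Real.sqrt (2 * Real.log (j + 1) / s))) T j hjT,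
      outExp_hoeffdingWeight_le hθ (ucbStrategy N hN0) i
        (1 * (4 * Real.sqrt (2 * Real.log (j + 1) / s))) T j hjT]
  rw [outExp_add, outExp_const, outExp_sum] at hmono
  simp only [outExp_sum] at hmono
  have hsum := (Finset.sum_le_sum fun j hj => Finset.sum_le_sum (htail j hj)).trans
    (sum_exp_neg_log_le T)
  change expY θ T (ucbStrategy N hN0) i ≤ _ at hmono
  linarith
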